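/- Let Σ be a finite arrangement of arcs in the plane (each arc separates the plane; any two arcs meet in at most one point, which is a crossing), and let a, b be points not on any arc. Then in the dual graph Σ* (vertices = faces of Σ, edges = segments of arcs between consecutive crossings) there is a path from the face containing a to the face containing b that crosses each arc of Σ at most once. -/

import Mathlib

open Set unitInterval

noncomputable section

/-- Two sets `S`, `T` cross transversally at `x`: some open neighbourhood of `x` is
homeomorphic to the plane by a chart sending `x` to the origin, `S` onto the horizontal
axis, and `T` onto the vertical axis. -/
def IsLocalCross (S T : Set (ℝ × ℝ)) (x : ℝ × ℝ) : Prop :=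
  ∃ (V : Set (ℝ × ℝ)) (_ : IsOpen V) (hx : x ∈ V) (h : V ≃ₜ ℝ × ℝ),
    h ⟨x, hx⟩ = 0 ∧
    (fun q : ℝ × ℝ => (h.symm q : ℝ × ℝ)) ⁻¹' S = {q : ℝ × ℝ | q.2 = 0} ∧
    (fun q : ℝ × ℝ => (h.symm q : ℝ × ℝ)) ⁻¹' T = {q : ℝ × ℝ | q.1 = 0}

/-- An arrangement of arcs in the plane: a finite set of simple open arcs, each of which
separates the plane, any two of which meet in at most one point, where they cross. -/
structure ArcArrangement where
  arcs : Set (Set (ℝ × ℝ))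
  finite : arcs.Finite
  isArc : ∀ S ∈ arcs, ∃ f : ℝ → ℝ × ℝ, Topology.IsEmbedding f ∧ Set.range f = S
  separates : ∀ S ∈ arcs, ¬ IsPreconnected Sᶜ
  meet_once : ∀ S ∈ arcs, ∀ T ∈ arcs, S ≠ T → (S ∩ T).Subsingleton
  meet_cross : ∀ S ∈ arcs, ∀ T ∈ arcs, S ≠ T → ∀ x ∈ S ∩ T, IsLocalCross S T x

namespace ArcArrangement

/-- The vertices of the arrangement: intersection points of two distinct arcs. -/
def vertexSet (A : ArcArrangement) : Set (ℝ × ℝ) :=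
  {x : ℝ × ℝ | ∃ S ∈ A.arcs, ∃ T ∈ A.arcs, S ≠ T ∧ x ∈ S ∩ T}

/-- A path is a "dual path" for the arrangement: it avoids all vertices of the
arrangement and meets each arc at most once. -/
def IsDualPath (A : ArcArrangement) {a b : ℝ × ℝ} (γ : Path a b) : Prop :=
  Disjoint (Set.range ⇑γ) A.vertexSet ∧
    ∀ S ∈ A.arcs, (Set.range ⇑γ ∩ S).Subsingleton

end ArcArrangement

/-- The standard identification of `ℝ × ℝ` with `ℂ`. -/
def planeToComplex : (ℝ × ℝ) ≃L[ℝ] ℂ := Complex.equivRealProdCLM.symm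

/-- The function `z ↦ (z - p) / (z - q)` has a continuous logarithm on `K`. -/
def HasLogRatio (K : Set (ℝ × ℝ)) (p q : ℝ × ℝ) : Prop :=
  ∃ g : ℝ × ℝ → ℂ, ContinuousOn g K ∧ ∀ z ∈ K,
    planeToComplex z - planeToComplex p =
      Complex.exp (g z) * (planeToComplex z - planeToComplex q)

lemma HasLogRatio.refl (K : Set (ℝ × ℝ)) (p : ℝ × ℝ) : HasLogRatio K p p :=
  ⟨fun _ => 0, continuousOn_const, fun z _ => by simp⟩

lemma HasLogRatio.symm {K : Set (ℝ × ℝ)} {p q : ℝ × ℝ} (h : HasLogRatio K p q) :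
    HasLogRatio K q p := by
  obtain ⟨g, hg, he⟩ := h
  refine ⟨fun z => - g z, hg.neg, fun z hz => ?_⟩
  rw [he z hz, ← mul_assoc, ← Complex.exp_add]
  simp

lemma HasLogRatio.trans {K : Set (ℝ × ℝ)} {p q r : ℝ × ℝ} (h : HasLogRatio K p q)
    (h' : HasLogRatio K q r) : HasLogRatio K p r := by
  obtain ⟨g, hg, he⟩ := h
  obtain ⟨g', hg', he'⟩ := h'
  refine ⟨fun z => g z + g' z, hg.add hg', fun z hz => ?_⟩
  rw [he z hz, he' z hz, ← mul_assoc, ← Complex.exp_add]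

open Topology in
lemma eventually_hasLogRatio {K : Set (ℝ × ℝ)} (hK : IsClosed K) {p : ℝ × ℝ} (hp : p ∉ K) :
    ∀ᶠ q in 𝓝 p, HasLogRatio K q p := by
  have hcl : IsClosed (planeToComplex '' K) :=
    planeToComplex.toHomeomorph.isClosedMap K hK
  have hnot : planeToComplex p ∈ (planeToComplex '' K)ᶜ := by
    rintro ⟨z, hz, h⟩
    exact hp (planeToComplex.injective h ▸ hz)
  obtain ⟨ε, hε, hball⟩ := Metric.isOpen_iff.1 hcl.isOpen_compl _ hnot
  have hev : ∀ᶠ q in 𝓝 p, planeToComplex q ∈ Metric.ball (planeToComplex p) ε :=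
    planeToComplex.continuous.continuousAt.eventually (Metric.ball_mem_nhds _ hε)
  filter_upwards [hev] with q hq
  have hpos : ∀ z ∈ K, ε ≤ ‖planeToComplex z - planeToComplex p‖ := by
    intro z hz
    by_contra! hlt
    exact hball (by rwa [Metric.mem_ball, dist_eq_norm]) ⟨z, hz, rfl⟩
  have hne : ∀ z ∈ K, planeToComplex z - planeToComplex p ≠ 0 := fun z hz h => by
    have := hpos z hz
    rw [h, norm_zero] at this
    linarith
  refine ⟨fun z => Complex.log ((planeToComplex z - planeToComplex q) /
    (planeToComplex z - planeToComplex p)), ?_, ?_⟩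
  · refine ContinuousOn.clog ?_ ?_
    · exact ContinuousOn.div (by fun_prop) (by fun_prop) hne
    · intro z hz
      left
      have h1 : (planeToComplex z - planeToComplex q) / (planeToComplex z - planeToComplex p)
          = 1 + (planeToComplex p - planeToComplex q) /
            (planeToComplex z - planeToComplex p) := by
        field_simp [hne z hz]
        ring
      have h2 : ‖(planeToComplex p - planeToComplex q) /
          (planeToComplex z - planeToComplex p)‖ < 1 := by
        rw [norm_div, div_lt_one (norm_pos_iff.2 (hne z hz))]
        rw [Metric.mem_ball, dist_comm, dist_eq_norm] at hq
        exact hq.trans_le (hpos z hz)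
      rw [h1, Complex.add_re, Complex.one_re]
      have := (abs_lt.1 ((Complex.abs_re_le_norm _).trans_lt h2)).1
      linarith
  · intro z hz
    have hq' : planeToComplex z - planeToComplex q ≠ 0 := fun h => hball hq
      ⟨z, hz, sub_eq_zero.1 h⟩
    rw [Complex.exp_log (div_ne_zero hq' (hne z hz)), div_mul_cancel₀ _ (hne z hz)]

open Topology in
/-- Two points joined in the complement of `K` have a logarithmic ratio on `K`. -/
lemma JoinedIn.hasLogRatio {K : Set (ℝ × ℝ)} (hK : IsClosed K) {p q : ℝ × ℝ}
    (h : JoinedIn Kᶜ p q) : HasLogRatio K p q := by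
  obtain ⟨γ, hγ⟩ := h
  have := PreconnectedSpace.induction₂' (α := I) (fun s t => HasLogRatio K (γ s) (γ t))
    (fun s => by
      filter_upwards [γ.continuous.continuousAt.eventually (eventually_hasLogRatio hK (hγ s))]
        with t ht
      exact ⟨ht.symm, ht⟩) ⟨fun _ _ _ h h' => h.trans h'⟩ 0 1
  simpa using this

/-- A continuous function whose exponential is constant on a preconnected set is constant. -/
lemma IsPreconnected.eq_of_exp_eq {α : Type*} [TopologicalSpace α] {s : Set α}
    (hs : IsPreconnected s) {u : α → ℂ} (hu : ContinuousOn u s)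
    (he : ∀ x ∈ s, ∀ y ∈ s, Complex.exp (u x) = Complex.exp (u y)) {x y : α} (hx : x ∈ s)
    (hy : y ∈ s) : u x = u y := by
  have hdisc : IsDiscrete (Set.range fun n : ℤ => (n : ℝ)) := by
    exact ⟨Int.isClosedEmbedding_coe_real.isEmbedding.toHomeomorph.symm.isEmbedding.discreteTopology⟩
  have key : ∀ z ∈ s, ∃ n : ℤ, u z = u x + n * (2 * Real.pi * Complex.I) := fun z hz =>
    Complex.exp_eq_exp_iff_exists_int.1 (he z hz x hx)
  have hv : ContinuousOn (fun z => ((u z - u x) / (2 * Real.pi * Complex.I)).re) s := by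
    fun_prop
  have hmaps : MapsTo (fun z => ((u z - u x) / (2 * Real.pi * Complex.I)).re) s
      (Set.range fun n : ℤ => (n : ℝ)) := by
    intro z hz
    obtain ⟨n, hn⟩ := key z hz
    refine ⟨n, ?_⟩
    simp only [hn, add_sub_cancel_left, mul_div_cancel_right₀ _ Complex.two_pi_I_ne_zero]
    simp
  have heq := hs.constant_of_mapsTo hdisc hv hmaps hx hy
  obtain ⟨n, hn⟩ := key y hy
  simp only [hn, add_sub_cancel_left, mul_div_cancel_right₀ _ Complex.two_pi_I_ne_zero] at heq
  simp at heq
  have hn0 : n = 0 := by exact_mod_cast heq.symm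
  simp [hn, hn0]

/-- Logarithmic ratios on two closed sets with preconnected intersection glue. -/
lemma HasLogRatio.union {A B : Set (ℝ × ℝ)} (hA : IsClosed A) (hB : IsClosed B)
    (hAB : IsPreconnected (A ∩ B)) {p q : ℝ × ℝ} (hq : q ∉ A ∩ B)
    (h : HasLogRatio A p q) (h' : HasLogRatio B p q) : HasLogRatio (A ∪ B) p q := by
  classical
  obtain ⟨g, hg, he⟩ := h
  obtain ⟨g', hg', he'⟩ := h'
  obtain ⟨k, hk, hgk⟩ : ∃ k : ℂ, Complex.exp k = 1 ∧ ∀ z ∈ A ∩ B, g z = g' z + k := by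
    have hexp : ∀ z ∈ A ∩ B, Complex.exp (g z - g' z) = 1 := by
      intro z hz
      have hne : planeToComplex z - planeToComplex q ≠ 0 := fun h0 =>
        hq (planeToComplex.injective (sub_eq_zero.1 h0) ▸ hz)
      have := mul_right_cancel₀ hne ((he z hz.1).symm.trans (he' z hz.2))
      rw [Complex.exp_sub, this, div_self (Complex.exp_ne_zero _)]
    rcases (A ∩ B).eq_empty_or_nonempty with h0 | ⟨w, hw⟩
    · exact ⟨0, by simp, by simp [h0]⟩
    · refine ⟨g w - g' w, hexp w hw, fun z hz => ?_⟩
      have := hAB.eq_of_exp_eq (u := fun z => g z - g' z)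
        ((hg.mono inter_subset_left).sub (hg'.mono inter_subset_right))
        (fun x hx y hy => (hexp x hx).trans (hexp y hy).symm) hz hw
      rw [← this]
      ring
  refine ⟨fun z => if z ∈ A then g z else g' z + k, ?_, ?_⟩
  · refine ContinuousOn.union_of_isClosed ?_ ?_ hA hB
    · exact hg.congr fun z hz => by simp [hz]
    · refine (hg'.add (continuousOn_const (c := k))).congr fun z hz => ?_
      by_cases hzA : z ∈ A
      · simp [hzA, hgk z ⟨hzA, hz⟩]
      · simp [hzA]
  · intro z hz
    by_cases hzA : z ∈ A
    · simp [hzA, he z hzA]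
    · simp [hzA, he' z (hz.resolve_left hzA), Complex.exp_add, hk]

/-- A nowhere vanishing function on a simply connected space has a continuous logarithm. -/
lemma exists_continuous_exp_eq {A : Type*} [TopologicalSpace A] [SimplyConnectedSpace A]
    [LocallyPathConnectedSpace A] (h : A → ℂ) (hc : Continuous h) (h0 : ∀ a, h a ≠ 0) :
    ∃ l : A → ℂ, Continuous l ∧ ∀ a, Complex.exp (l a) = h a := by
  obtain ⟨a₀⟩ := (inferInstance : Nonempty A)
  obtain ⟨F, ⟨-, hF⟩, -⟩ := Complex.isCoveringMapOn_exp.existsUnique_continuousMap_lifts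
    ⟨h, hc⟩ (a₀ := a₀) (Complex.exp_log (h0 a₀)) h0
  exact ⟨F, F.continuous, fun a => congrFun hF a⟩

/-- Compact subarcs carry logarithmic ratios. -/
lemma hasLogRatio_image_Icc {f : ℝ → ℝ × ℝ} (hf : Topology.IsEmbedding f) (s t : ℝ)
    {p q : ℝ × ℝ} (hp : p ∉ f '' Icc s t) (hq : q ∉ f '' Icc s t) :
    HasLogRatio (f '' Icc s t) p q := by
  rcases le_or_gt s t with hst | hst
  swap
  · exact ⟨0, by simp [Icc_eq_empty_of_lt hst], by simp [Icc_eq_empty_of_lt hst]⟩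
  have hne : ∀ (w : ℝ × ℝ) (_ : w ∉ f '' Icc s t) (r : ℝ),
      planeToComplex (f (projIcc s t hst r)) - planeToComplex w ≠ 0 := fun w hw r h0 =>
    hw ⟨_, (projIcc s t hst r).2, planeToComplex.injective (sub_eq_zero.1 h0)⟩
  have hfc := hf.continuous
  have hpc : Continuous fun r => ((projIcc s t hst r : Icc s t) : ℝ) :=
    continuous_subtype_val.comp continuous_projIcc
  obtain ⟨l, hl, hle⟩ := exists_continuous_exp_eq
    (fun r : ℝ => (planeToComplex (f (projIcc s t hst r)) - planeToComplex p) /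
      (planeToComplex (f (projIcc s t hst r)) - planeToComplex q))
    (Continuous.div (by fun_prop) (by fun_prop) (hne q hq))
    (fun r => div_ne_zero (hne p hp r) (hne q hq r))
  refine ⟨fun z => l (Function.invFun f z), ?_, ?_⟩
  · rw [hf.isInducing.continuousOn_image_iff]
    exact hl.continuousOn.congr fun r _ => by simp [Function.leftInverse_invFun hf.injective r]
  · rintro _ ⟨r, hr, rfl⟩
    simp only [Function.leftInverse_invFun hf.injective r]
    rw [hle, projIcc_of_mem hst hr]
    rw [div_mul_cancel₀]
    simpa [projIcc_of_mem hst hr] using hne q hq r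

/-- Two points outside a closed set with bounded complement, on which they have a logarithmic
ratio, are joined in the complement. -/
lemma HasLogRatio.joinedIn {K : Set (ℝ × ℝ)} (hK : IsClosed K)
    (hb : Bornology.IsBounded Kᶜ) {p q : ℝ × ℝ} (hp : p ∉ K)
    (h : HasLogRatio K p q) : JoinedIn Kᶜ p q := by
  classical
  by_contra hpq
  set U := pathComponentIn Kᶜ p with hU
  have hUo : IsOpen U := hK.isOpen_compl.pathComponentIn p
  have hUK : U ⊆ Kᶜ := pathComponentIn_subset
  have hfr : frontier U ⊆ K := by
    intro w hw
    by_contra hwK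
    have hwo : IsOpen (pathComponentIn Kᶜ w) := hK.isOpen_compl.pathComponentIn w
    obtain ⟨v, hv, hv'⟩ := mem_closure_iff.1 hw.1 _ hwo (mem_pathComponentIn_self hwK)
    apply hw.2
    rw [hUo.interior_eq]
    exact JoinedIn.trans hv' (JoinedIn.symm hv)
  obtain ⟨g, hg, he⟩ := h
  obtain ⟨G, hG⟩ := ContinuousMap.exists_restrict_eq (Y := ℂ) hK
    ⟨K.domRestrict g, continuousOn_iff_continuous_domRestrict.1 hg⟩
  have hGg : ∀ z ∈ K, G z = g z := fun z hz => congrArg (fun F => F ⟨z, hz⟩) hG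
  obtain ⟨l, hl, hle⟩ := exists_continuous_exp_eq
    (fun z => if z ∈ U then Complex.exp (G z) * (planeToComplex z - planeToComplex q)
      else planeToComplex z - planeToComplex p) (by
      refine Continuous.if ?_ (by fun_prop) (by fun_prop)
      intro w hw
      have hwK := hfr hw
      rw [hGg w hwK, he w hwK]) (by
      intro z
      split_ifs with hz
      · refine mul_ne_zero (Complex.exp_ne_zero _) fun h0 => hpq ?_
        rw [← planeToComplex.injective (sub_eq_zero.1 h0)]
        exact hz
      · intro h0
        rw [planeToComplex.injective (sub_eq_zero.1 h0)] at hz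
        exact hz (mem_pathComponentIn_self hp))
  have hbU : Bornology.IsBounded (planeToComplex '' U) :=
    planeToComplex.lipschitz.isBounded_image (hb.subset hUK)
  obtain ⟨R, hR0, hR⟩ := hbU.subset_ball_lt 0 (planeToComplex p)
  let c : ℝ → ℝ × ℝ := fun t =>
    planeToComplex.symm (planeToComplex p + R * Complex.exp (t * Complex.I))
  have hc : Continuous c := by
    simp only [c]
    fun_prop
  have hcU : ∀ t, c t ∉ U := fun t ht => by
    have := hR ⟨_, ht, rfl⟩
    simp [c, Complex.norm_exp_ofReal_mul_I, abs_of_pos hR0] at this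
  have hexp : ∀ t : ℝ, Complex.exp (l (c t) - t * Complex.I) = R := fun t => by
    rw [Complex.exp_sub, hle, if_neg (hcU t)]
    simp [c, Complex.exp_ne_zero]
  have hconst := isPreconnected_univ.eq_of_exp_eq (u := fun t : ℝ => l (c t) - t * Complex.I)
    (by fun_prop) (fun x _ y _ => (hexp x).trans (hexp y).symm) (mem_univ 0)
    (mem_univ (2 * Real.pi))
  have hcc : c (2 * Real.pi) = c 0 := by
    simp [c, Complex.exp_two_pi_mul_I]
  simp [hcc] at hconst
  exact Complex.two_pi_I_ne_zero (by linear_combination hconst)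

lemma exists_ball_hasLogRatio {M : Set (ℝ × ℝ)} (hM : IsClosed M) {x : ℝ × ℝ} (hx : x ∉ M) :
    ∃ ε > 0, Metric.ball x ε ⊆ Mᶜ ∧
      ∀ p ∈ Metric.ball x ε, ∀ q ∈ Metric.ball x ε, HasLogRatio M p q := by
  obtain ⟨ε, hε, hb⟩ := Metric.isOpen_iff.1 hM.isOpen_compl x hx
  exact ⟨ε, hε, hb, fun p hp q hq => JoinedIn.hasLogRatio hM
    (((Metric.isPathConnected_ball hε).joinedIn p hp q hq).mono hb)⟩

lemma Topology.IsEmbedding.exists_image_Icc_subset {f : ℝ → ℝ × ℝ} (hf : Topology.IsEmbedding f)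
    (r₀ : ℝ) {O : Set (ℝ × ℝ)} (hO : IsOpen O) (hx : f r₀ ∈ O) :
    ∃ η > 0, ∀ r, |r - r₀| ≤ η → f r ∈ O := by
  obtain ⟨ε, hε, hb⟩ := Metric.isOpen_iff.1 (hO.preimage hf.continuous) r₀ hx
  refine ⟨ε / 2, by positivity, fun r hr => hb ?_⟩
  rw [Metric.mem_ball, Real.dist_eq]
  linarith

lemma isClosed_setOf_le_abs_sub (η r₀ : ℝ) : IsClosed {r : ℝ | η ≤ |r - r₀|} :=
  isClosed_le continuous_const (by fun_prop)

/-- Points of a neighbourhood of `f r₀` off the arc are joined to every nearby point `f r₁` of the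
arc by a local path meeting the arc only near `f r₁`. -/
lemma Topology.IsEmbedding.exists_joinedIn_point {f : ℝ → ℝ × ℝ} (hf : Topology.IsEmbedding f)
    (r₀ : ℝ) {O : Set (ℝ × ℝ)} (hO : IsOpen O) (hx : f r₀ ∈ O) :
    ∃ N, IsOpen N ∧ f r₀ ∈ N ∧ ∀ r₁, f r₁ ∈ N → ∀ ρ > 0, ∀ y ∈ N, y ∉ range f →
      JoinedIn (O \ f '' {r | ρ ≤ |r - r₁|}) y (f r₁) := by
  set O' := O ∩ Metric.ball (f r₀) 1 with hO'
  have hO'o : IsOpen O' := hO.inter Metric.isOpen_ball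
  have hxO' : f r₀ ∈ O' := ⟨hx, Metric.mem_ball_self one_pos⟩
  obtain ⟨η, hη, hηO⟩ := hf.exists_image_Icc_subset r₀ hO'o hxO'
  set M := O'ᶜ ∪ closure (f '' {r | η ≤ |r - r₀|}) with hM
  have hMc : IsClosed M := hO'o.isClosed_compl.union isClosed_closure
  have hcl : ∀ r, f r ∈ closure (f '' {r | η ≤ |r - r₀|}) → η ≤ |r - r₀| := fun r hr => by
    have := hf.isInducing.closure_eq_preimage_closure_image {r | η ≤ |r - r₀|}
    rw [(isClosed_setOf_le_abs_sub η r₀).closure_eq] at this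
    exact this.symm.subset hr
  have hMr : ∀ r, f r ∈ M → η ≤ |r - r₀| := fun r hr => by
    rcases hr with hr | hr
    · by_contra! h
      exact hr (hηO r h.le)
    · exact hcl r hr
  have hxM : f r₀ ∉ M := fun h => by
    have := hMr _ h
    simp at this
    linarith
  obtain ⟨ε, hε, hεM, hlog⟩ := exists_ball_hasLogRatio hMc hxM
  refine ⟨_, Metric.isOpen_ball, Metric.mem_ball_self hε, fun r₁ hr₁ ρ hρ y hy hyS => ?_⟩
  have hr₁η : |r₁ - r₀| < η := by
    by_contra! h
    exact hεM hr₁ (Or.inr (subset_closure ⟨r₁, h, rfl⟩))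
  rw [abs_lt] at hr₁η
  set J₁ := f '' Icc (r₀ - η) (r₁ - ρ) with hJ₁
  set J₂ := f '' Icc (r₁ + ρ) (r₀ + η) with hJ₂
  have hJ₁c : IsClosed J₁ := (isCompact_Icc.image hf.continuous).isClosed
  have hJ₂c : IsClosed J₂ := (isCompact_Icc.image hf.continuous).isClosed
  have hr₁J₁ : f r₁ ∉ J₁ := by
    rintro ⟨r, hr, he⟩
    rw [hf.injective he] at hr
    linarith [hr.2]
  have hr₁J₂ : f r₁ ∉ J₂ := by
    rintro ⟨r, hr, he⟩
    rw [hf.injective he] at hr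
    linarith [hr.1]
  have hyJ : ∀ s t, y ∉ f '' Icc s t := fun s t => by
    rintro ⟨r, -, rfl⟩
    exact hyS ⟨r, rfl⟩
  have hMJ₁ : (M ∩ J₁).Subsingleton := by
    refine (subsingleton_singleton (a := f (r₀ - η))).anti ?_
    rintro _ ⟨hm, r, hr, rfl⟩
    have := hMr r hm
    rcases le_abs'.1 this with h | h
    · rw [show r = r₀ - η by linarith [hr.1]]
      rfl
    · linarith [hr.2]
  have hMJ₂ : ((M ∪ J₁) ∩ J₂).Subsingleton := by
    refine (subsingleton_singleton (a := f (r₀ + η))).anti ?_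
    rintro _ ⟨hm | ⟨r', hr', he⟩, r, hr, rfl⟩
    · have := hMr r hm
      rcases le_abs'.1 this with h | h
      · linarith [hr.1]
      · rw [show r = r₀ + η by linarith [hr.2]]
        rfl
    · have := hf.injective he
      linarith [hr.1, hr'.2]
  have h₁ : HasLogRatio (M ∪ J₁) y (f r₁) :=
    HasLogRatio.union hMc hJ₁c hMJ₁.isPreconnected (fun h => hr₁J₁ h.2) (hlog y hy _ hr₁)
      (hasLogRatio_image_Icc hf _ _ (hyJ _ _) hr₁J₁)
  have h₂ : HasLogRatio ((M ∪ J₁) ∪ J₂) y (f r₁) :=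
    HasLogRatio.union (hMc.union hJ₁c) hJ₂c hMJ₂.isPreconnected (fun h => hr₁J₂ h.2) h₁
      (hasLogRatio_image_Icc hf _ _ (hyJ _ _) hr₁J₂)
  have hsub : ((M ∪ J₁) ∪ J₂)ᶜ ⊆ O' := fun w hw => by
    by_contra h
    exact hw (Or.inl (Or.inl (Or.inl h)))
  refine (h₂.joinedIn ((hMc.union hJ₁c).union hJ₂c)
    (Metric.isBounded_ball.subset (hsub.trans inter_subset_right)) ?_).mono ?_
  · rintro ((h | h) | h)
    exacts [hεM hy h, hyJ _ _ h, hyJ _ _ h]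
  · refine fun w hw => ⟨(hsub hw).1, ?_⟩
    rintro ⟨r, hr, rfl⟩
    rcases le_or_gt η |r - r₀| with h | h
    · exact hw (Or.inl (Or.inl (Or.inr (subset_closure ⟨r, h, rfl⟩))))
    · rw [abs_lt] at h
      rcases le_abs'.1 (show ρ ≤ |r - r₁| from hr) with h' | h'
      · exact hw (Or.inl (Or.inr ⟨r, ⟨by linarith, by linarith⟩, rfl⟩))
      · exact hw (Or.inr ⟨r, ⟨by linarith, by linarith⟩, rfl⟩)

lemma Topology.IsEmbedding.dense_compl_range {f : ℝ → ℝ × ℝ} (hf : Topology.IsEmbedding f) :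
    Dense (range f)ᶜ := by
  rw [← interior_eq_empty_iff_dense_compl, eq_empty_iff_forall_notMem]
  intro x hx
  obtain ⟨ε, hε, hb⟩ := Metric.isOpen_iff.1 isOpen_interior x hx
  let c : ℝ → ℝ × ℝ := fun θ => x + (ε / 2 * Real.cos θ, ε / 2 * Real.sin θ)
  have hc : ∀ θ, c θ ∈ range f := fun θ => by
    refine interior_subset (hb ?_)
    rw [mem_ball_iff_norm, Prod.norm_def]
    have h₁ := Real.abs_cos_le_one θ
    have h₂ := Real.abs_sin_le_one θ
    simp only [c, add_sub_cancel_left, Real.norm_eq_abs, abs_mul, abs_of_pos (half_pos hε)]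
    exact max_lt (by nlinarith) (by nlinarith)
  choose h hh using hc
  have hcont : Continuous h := by
    rw [hf.isInducing.continuous_iff, show f ∘ h = c from funext hh]
    fun_prop
  have h2 : h (Real.pi + Real.pi) = h 0 := by
    apply hf.injective
    rw [hh, hh]
    simp [c, ← two_mul]
  obtain ⟨θ, hθ⟩ : (0 : ℝ) ∈ range fun θ => h θ - h (θ + Real.pi) := by
    have hk : Continuous fun θ => h θ - h (θ + Real.pi) := by fun_prop
    rcases le_total (h 0) (h Real.pi) with hle | hle
    · refine mem_range_of_exists_le_of_exists_ge hk ⟨0, ?_⟩ ⟨Real.pi, ?_⟩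
      · simpa using hle
      · simpa [h2] using hle
    · refine mem_range_of_exists_le_of_exists_ge hk ⟨Real.pi, ?_⟩ ⟨0, ?_⟩
      · simpa [h2] using hle
      · simpa using hle
  have heq : c θ = c (θ + Real.pi) := by rw [← hh, ← hh, sub_eq_zero.1 hθ]
  have h₁ : ε / 2 * Real.cos θ = ε / 2 * -Real.cos θ := by
    simpa [c] using congrArg Prod.fst heq
  have h₂ : ε / 2 * Real.sin θ = ε / 2 * -Real.sin θ := by
    simpa [c] using congrArg Prod.snd heq
  have := mul_left_cancel₀ (half_pos hε).ne' h₁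
  have := mul_left_cancel₀ (half_pos hε).ne' h₂
  nlinarith [Real.sin_sq_add_cos_sq θ]

/-- If an open pair `u`, `v` separates the complement of an arc, then the arc lies in the closure
of the `v`-part. -/
lemma Topology.IsEmbedding.range_subset_closure {f : ℝ → ℝ × ℝ} (hf : Topology.IsEmbedding f)
    {u v : Set (ℝ × ℝ)} (hu : IsOpen u) (hv : IsOpen v) (huv : (range f)ᶜ ⊆ u ∪ v)
    (hd : ∀ w, w ∉ range f → w ∈ u → w ∉ v) (hune : ((range f)ᶜ ∩ u).Nonempty)
    (hvne : ((range f)ᶜ ∩ v).Nonempty) : range f ⊆ closure ((range f)ᶜ ∩ v) := by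
  set Q := (range f)ᶜ ∩ v with hQ
  have hC : IsClopen {r | f r ∈ closure Q} := by
    refine ⟨isClosed_closure.preimage hf.continuous, isOpen_iff_mem_nhds.2 fun r₀ hr₀ => ?_⟩
    obtain ⟨N, hN, hxN, hjoin⟩ := hf.exists_joinedIn_point r₀ isOpen_univ (mem_univ _)
    filter_upwards [(hN.preimage hf.continuous).mem_nhds hxN] with r₁ hr₁
    by_contra hcl
    obtain ⟨ε, hε, hb⟩ := Metric.isOpen_iff.1 isClosed_closure.isOpen_compl _ hcl
    obtain ⟨ρ, hρ, hρb⟩ := hf.exists_image_Icc_subset r₁ Metric.isOpen_ball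
      (Metric.mem_ball_self (half_pos hε))
    obtain ⟨y, hyN, hyQ⟩ := mem_closure_iff.1 hr₀ N hN hxN
    obtain ⟨Γ, hΓ⟩ := hjoin r₁ hr₁ ρ hρ y hyN hyQ.1
    have hΓS : ∀ t, Γ t ∈ range f → Γ t ∈ Metric.ball (f r₁) (ε / 2) := fun t ht => by
      obtain ⟨r, hr⟩ := ht
      rw [← hr]
      refine hρb r (le_of_not_ge fun h => (hΓ t).2 ⟨r, h, hr⟩)
    have hQb : ∀ w ∈ Q, w ∉ Metric.ball (f r₁) ε := fun w hw h => hb h (subset_closure hw)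
    have hlt : Metric.closedBall (f r₁) (ε / 2) ⊆ Metric.ball (f r₁) ε :=
      Metric.closedBall_subset_ball (half_lt_self hε)
    obtain ⟨_, ⟨t, rfl⟩, ⟨h₁, h₂⟩, h₃⟩ := (isPreconnected_range Γ.continuous)
      (v \ Metric.closedBall (f r₁) (ε / 2)) (u ∪ Metric.ball (f r₁) ε)
      (hv.sdiff Metric.isClosed_closedBall) (hu.union Metric.isOpen_ball) (by
        rintro _ ⟨t, rfl⟩
        by_cases hS : Γ t ∈ range f
        · exact Or.inr (Or.inr (hlt (Metric.ball_subset_closedBall (hΓS t hS))))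
        · rcases huv hS with h | h
          · exact Or.inr (Or.inl h)
          · exact Or.inl ⟨h, fun h' => hQb _ ⟨hS, h⟩ (hlt h')⟩)
      ⟨y, ⟨0, Γ.source⟩, hyQ.2, fun h => hQb _ hyQ (hlt h)⟩
      ⟨f r₁, ⟨1, Γ.target⟩, Or.inr (Metric.mem_ball_self hε)⟩
    have hS : Γ t ∉ range f := fun h => h₂ (Metric.ball_subset_closedBall (hΓS t h))
    rcases h₃ with h | h
    · exact hd _ hS h h₁
    · exact hQb _ ⟨hS, h₁⟩ h
  rcases isClopen_iff.1 hC with h | h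
  swap
  · rintro _ ⟨r, rfl⟩
    exact h.symm.subset (mem_univ r)
  have hSQ : ∀ w ∈ closure Q, w ∉ range f := by
    rintro _ hw ⟨r, rfl⟩
    exact h.subset (show r ∈ {r | f r ∈ closure Q} from hw)
  have hQc : IsClosed Q := by
    refine isClosed_of_closure_subset fun w hw => ⟨hSQ w hw, ?_⟩
    rcases huv (hSQ w hw) with h | h
    · obtain ⟨z, hz, hz'⟩ := mem_closure_iff.1 hw u hu h
      exact absurd hz'.2 (hd z hz'.1 hz)
    · exact h
  have hQo : IsOpen Q := by
    have : Q = v := by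
      refine inter_eq_right.2 fun w hwv hwS => ?_
      obtain ⟨z, hz, hzS⟩ := hf.dense_compl_range.inter_open_nonempty (v ∩ (closure Q)ᶜ)
        (hv.inter isClosed_closure.isOpen_compl) ⟨w, hwv, fun h => hSQ w h hwS⟩
      exact hz.2 (subset_closure ⟨hzS, hz.1⟩)
    rwa [this]
  obtain ⟨z, hz, hzu⟩ := hune
  rcases isClopen_iff.1 ⟨hQc, hQo⟩ with h | h
  · exact absurd h hvne.ne_empty
  · exact absurd (h.symm.subset (mem_univ z)).2 (hd z hz hzu)

/-- A properly embedded line all of whose complementary components accumulate at every point of the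
line, and with at least two complementary components. -/
structure IsSeparatingArc (f : ℝ → ℝ × ℝ) : Prop where
  isClosedEmbedding : Topology.IsClosedEmbedding f
  subset_closure : ∀ w ∉ range f, range f ⊆ closure (pathComponentIn (range f)ᶜ w)
  exists_not_joinedIn : ∃ p q, p ∉ range f ∧ q ∉ range f ∧ ¬ JoinedIn (range f)ᶜ p q

lemma isOpen_diff_pathComponentIn {F : Set (ℝ × ℝ)} (hF : IsOpen F) (w : ℝ × ℝ) :
    IsOpen (F \ pathComponentIn F w) := by
  refine isOpen_iff_mem_nhds.2 fun z hz => ?_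
  filter_upwards [(hF.pathComponentIn z).mem_nhds (mem_pathComponentIn_self hz.1)] with y hy
  exact ⟨pathComponentIn_subset hy, fun h => hz.2 (h.trans hy.symm)⟩

lemma Topology.IsEmbedding.isSeparatingArc {f : ℝ → ℝ × ℝ} (hf : Topology.IsEmbedding f)
    (hs : ¬ IsPreconnected (range f)ᶜ) : IsSeparatingArc f := by
  simp only [IsPreconnected, not_forall] at hs
  obtain ⟨u, v, hu, hv, huv, hune, hvne, hd⟩ := hs
  have hd' : ∀ w, w ∉ range f → w ∈ u → w ∉ v := fun w h₁ h₂ h₃ => hd ⟨w, h₁, h₂, h₃⟩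
  have hQ := hf.range_subset_closure hu hv huv hd' hune hvne
  have hP := hf.range_subset_closure hv hu (huv.trans (union_comm u v).subset)
    (fun w h₁ h₂ h₃ => hd' w h₁ h₃ h₂) hvne hune
  have hcl : IsClosed (range f) := by
    refine isClosed_of_closure_subset fun w hw => by_contra fun hwS => ?_
    rcases huv hwS with h | h
    · obtain ⟨s, hs, hsS⟩ := mem_closure_iff.1 hw u hu h
      obtain ⟨z, hz, hz'⟩ := mem_closure_iff.1 (hQ hsS) u hu hs
      exact hd' z hz'.1 hz hz'.2
    · obtain ⟨s, hs, hsS⟩ := mem_closure_iff.1 hw v hv h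
      obtain ⟨z, hz, hz'⟩ := mem_closure_iff.1 (hP hsS) v hv hs
      exact hd' z hz'.1 hz'.2 hz
  obtain ⟨p, hp, hpu⟩ := hune
  obtain ⟨q, hq, hqv⟩ := hvne
  have hpq : ¬ JoinedIn (range f)ᶜ p q := by
    rintro ⟨Γ, hΓ⟩
    obtain ⟨_, ⟨t, rfl⟩, h₁, h₂⟩ := isPreconnected_range Γ.continuous u v hu hv
      (by rintro _ ⟨t, rfl⟩; exact huv (hΓ t)) ⟨p, ⟨0, Γ.source⟩, hpu⟩ ⟨q, ⟨1, Γ.target⟩, hqv⟩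
    exact hd' _ (hΓ t) h₁ h₂
  refine ⟨⟨hf, hcl⟩, fun w hw => ?_, p, q, hp, hq, hpq⟩
  have hne : ((range f)ᶜ ∩ ((range f)ᶜ \ pathComponentIn (range f)ᶜ w)).Nonempty := by
    by_cases h : p ∈ pathComponentIn (range f)ᶜ w
    · exact ⟨q, hq, hq, fun h' => hpq (h.symm.trans h')⟩
    · exact ⟨p, hp, hp, h⟩
  have := hf.range_subset_closure (isOpen_diff_pathComponentIn hcl.isOpen_compl w)
    (hcl.isOpen_compl.pathComponentIn w)
    (fun z hz => (em' _).imp (fun h => ⟨hz, h⟩) id) (fun z _ hz => hz.2) hne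
    ⟨w, hw, mem_pathComponentIn_self hw⟩
  exact this.trans (closure_mono inter_subset_right)

lemma isConnected_setOf_le_norm (R : ℝ) :
    IsConnected {x : ℝ × ℝ | R ≤ ‖planeToComplex x‖} := by
  have : {x : ℝ × ℝ | R ≤ ‖planeToComplex x‖} =
      (fun z : ℝ × ℝ => planeToComplex.symm (z.1 * Complex.exp (z.2 * Complex.I))) ''
        (Ici R ×ˢ univ) := by
    ext x
    constructor
    · refine fun hx => ⟨(‖planeToComplex x‖, Complex.arg (planeToComplex x)), ⟨hx, trivial⟩, ?_⟩
      simp [Complex.norm_mul_exp_arg_mul_I]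
    · rintro ⟨⟨r, θ⟩, ⟨hr, -⟩, rfl⟩
      have hr' : R ≤ r := hr
      simpa [Complex.norm_exp_ofReal_mul_I] using hr'.trans (le_abs_self r)
  rw [this]
  exact (isConnected_Ici.prod isConnected_univ).image _ (by fun_prop)

/-- Local connectivity of the sides of a separating arc. -/
lemma Topology.IsClosedEmbedding.exists_joinedIn_diff {f : ℝ → ℝ × ℝ}
    (hf : Topology.IsClosedEmbedding f) (r₀ : ℝ) {O : Set (ℝ × ℝ)} (hO : IsOpen O)
    (hx : f r₀ ∈ O) :
    ∃ N, IsOpen N ∧ f r₀ ∈ N ∧ N ⊆ O ∧ ∀ y ∈ N, ∀ z ∈ N, JoinedIn (range f)ᶜ y z →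
      JoinedIn (O \ range f) y z := by
  set O' := O ∩ Metric.ball (f r₀) 1 with hO'
  have hO'o : IsOpen O' := hO.inter Metric.isOpen_ball
  have hxO' : f r₀ ∈ O' := ⟨hx, Metric.mem_ball_self one_pos⟩
  obtain ⟨η, hη, hηO⟩ := hf.isEmbedding.exists_image_Icc_subset r₀ hO'o hxO'
  set E := f '' {r | η ≤ |r - r₀|} with hE
  have hEc : IsClosed E := hf.isClosedMap _ (isClosed_setOf_le_abs_sub η r₀)
  set M := O'ᶜ ∪ E with hM
  have hMc : IsClosed M := hO'o.isClosed_compl.union hEc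
  have hxM : f r₀ ∉ M := by
    rintro (h | ⟨r, hr, he⟩)
    · exact h hxO'
    · rw [hf.injective he] at hr
      simp at hr
      linarith
  obtain ⟨ε, hε, hεM, hlog⟩ := exists_ball_hasLogRatio hMc hxM
  have hNO : Metric.ball (f r₀) ε ⊆ O' := fun w hw => by
    by_contra h
    exact hεM hw (Or.inl h)
  refine ⟨_, Metric.isOpen_ball, Metric.mem_ball_self hε, hNO.trans inter_subset_left,
    fun y hy z hz hyz => ?_⟩
  obtain ⟨Γ, hΓ⟩ := hyz
  obtain ⟨R, hR⟩ : ∃ R, planeToComplex '' (O' ∪ range Γ) ⊆ Metric.ball 0 R := by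
    refine (planeToComplex.lipschitz.isBounded_image ?_).subset_ball 0
    exact (Metric.isBounded_ball.subset inter_subset_right).union
      (isCompact_range Γ.continuous).isBounded
  set B := {x : ℝ × ℝ | R ≤ ‖planeToComplex x‖} with hB
  have hBc : IsClosed B := isClosed_le continuous_const (by fun_prop)
  have hBO : ∀ x ∈ B, x ∉ O' ∪ range Γ := fun x hxB hxO => by
    have := hR ⟨x, hxO, rfl⟩
    rw [mem_ball_zero_iff] at this
    exact absurd hxB (not_le.2 this)
  set A := range f ∪ B with hA
  have hAc : IsClosed A := hf.isClosed_range.union hBc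
  have hAM : A ∩ M = E ∪ B := by
    ext w
    constructor
    · rintro ⟨⟨r, rfl⟩ | h, h' | h'⟩
      · refine Or.inl ⟨r, ?_, rfl⟩
        by_contra! hlt
        exact h' (hηO r (le_of_lt (not_le.1 hlt)))
      · exact Or.inl h'
      · exact Or.inr h
      · exact Or.inl h'
    · rintro (h | h)
      · exact ⟨Or.inl (image_subset_range _ _ h), Or.inr h⟩
      · exact ⟨Or.inr h, Or.inl fun h' => hBO w h (Or.inl h')⟩
  have hconn : IsPreconnected (A ∩ M) := by
    have hev : ∀ᶠ r in Filter.cocompact ℝ, f r ∈ B :=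
      (tendsto_norm_cocompact_atTop.comp (planeToComplex.toHomeomorph.isClosedEmbedding.comp
        hf).tendsto_cocompact).eventually_ge_atTop R
    obtain ⟨r₁, h₁, hr₁⟩ := ((hev.filter_mono atBot_le_cocompact).and
      (Filter.eventually_le_atBot (r₀ - η))).exists
    obtain ⟨r₂, h₂, hr₂⟩ := ((hev.filter_mono atTop_le_cocompact).and
      (Filter.eventually_ge_atTop (r₀ + η))).exists
    have hE' : E = f '' Iic (r₀ - η) ∪ f '' Ici (r₀ + η) := by
      rw [hE, ← image_union]
      congr 1
      ext r
      simp only [mem_ofPred_eq, mem_union, mem_Iic, mem_Ici, le_abs']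
      constructor <;> rintro (h | h)
      exacts [Or.inl (by linarith), Or.inr (by linarith), Or.inl (by linarith),
        Or.inr (by linarith)]
    have hBcon := (isConnected_setOf_le_norm R).isPreconnected
    rw [hAM, hE', union_assoc]
    refine IsPreconnected.union' ⟨f r₁, ⟨r₁, hr₁, rfl⟩, Or.inr h₁⟩
      (isPreconnected_Iic.image f hf.continuous.continuousOn) ?_
    exact IsPreconnected.union' ⟨f r₂, ⟨r₂, hr₂, rfl⟩, h₂⟩
      (isPreconnected_Ici.image f hf.continuous.continuousOn) hBcon
  have hyS : y ∉ range f := by simpa using hΓ 0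
  have hzS : z ∉ range f := by simpa using hΓ 1
  have hAΓ : JoinedIn Aᶜ y z := by
    refine ⟨Γ, fun t => ?_⟩
    rintro (h | h)
    · exact hΓ t h
    · exact hBO _ h (Or.inr ⟨t, rfl⟩)
  have h := HasLogRatio.union hAc hMc hconn (fun h => hAΓ.target_mem h.1)
    (hAΓ.hasLogRatio hAc) (hlog y hy z hz)
  have hsub : (A ∪ M)ᶜ ⊆ O' := fun w hw => by
    by_contra h
    exact hw (Or.inr (Or.inl h))
  refine (h.joinedIn (hAc.union hMc)
    (Metric.isBounded_ball.subset (hsub.trans inter_subset_right)) ?_).mono ?_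
  · rintro (h | h)
    exacts [hAΓ.source_mem h, hεM hy h]
  · exact fun w hw => ⟨(hsub hw).1, fun h => hw (Or.inl (Or.inl h))⟩

lemma IsSeparatingArc.exists_mem_joinedIn {f : ℝ → ℝ × ℝ} (hf : IsSeparatingArc f) {w : ℝ × ℝ}
    (hw : w ∉ range f) {N : Set (ℝ × ℝ)} (hN : IsOpen N) {r : ℝ} (hr : f r ∈ N) :
    ∃ m ∈ N, JoinedIn (range f)ᶜ w m :=
  mem_closure_iff.1 (hf.subset_closure w hw ⟨r, rfl⟩) N hN hr

/-- Sides of a separating arc are connected inside thin neighbourhoods of compact subarcs. -/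
lemma IsSeparatingArc.exists_strip {f : ℝ → ℝ × ℝ} (hf : IsSeparatingArc f) (s t : ℝ)
    {O : Set (ℝ × ℝ)} (hO : IsOpen O) (hst : f '' Icc s t ⊆ O) :
    ∃ N, IsOpen N ∧ f '' Icc s t ⊆ N ∧ N ⊆ O ∧ ∀ y ∈ N, ∀ z ∈ N, JoinedIn (range f)ᶜ y z →
      JoinedIn (O \ range f) y z := by
  have key : ∀ r : Icc s t, ∃ N, IsOpen N ∧ f r ∈ N ∧ N ⊆ O ∧ ∀ y ∈ N, ∀ z ∈ N,
      JoinedIn (range f)ᶜ y z → JoinedIn (O \ range f) y z := fun r =>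
    hf.isClosedEmbedding.exists_joinedIn_diff r hO (hst ⟨r, r.2, rfl⟩)
  choose N hNo hrN hNO hN using key
  refine ⟨⋃ r, N r, isOpen_iUnion hNo, ?_, iUnion_subset hNO, fun y hy z hz hyz => ?_⟩
  · rintro _ ⟨r, hr, rfl⟩
    exact mem_iUnion.2 ⟨⟨r, hr⟩, hrN ⟨r, hr⟩⟩
  obtain ⟨r, hr⟩ := mem_iUnion.1 hy
  obtain ⟨r', hr'⟩ := mem_iUnion.1 hz
  have hconn : PreconnectedSpace (Icc s t) :=
    isPreconnected_iff_preconnectedSpace.1 isPreconnected_Icc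
  have hfc := hf.isClosedEmbedding.continuous
  have hyS : y ∉ range f := hyz.source_mem
  have hrel : ∀ y' ∈ N r, ∀ z' ∈ N r', JoinedIn (range f)ᶜ y y' → JoinedIn (range f)ᶜ y z' →
      JoinedIn (O \ range f) y' z' := by
    let Rel : Icc s t → Icc s t → Prop := fun r r' => ∀ y' ∈ N r, ∀ z' ∈ N r',
      JoinedIn (range f)ᶜ y y' → JoinedIn (range f)ᶜ y z' → JoinedIn (O \ range f) y' z'
    have hsymm : Std.Symm Rel :=
      ⟨fun r₁ r₂ h y' hy' z' hz' hyy' hyz' => (h z' hz' y' hy' hyz' hyy').symm⟩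
    refine PreconnectedSpace.induction₂ Rel (fun r => ?_) ?_ r r'
    · filter_upwards [((hNo r).preimage (hfc.comp continuous_subtype_val)).mem_nhds (hrN r)]
        with r' hr' y' hy' z' hz' hyy' hyz'
      obtain ⟨m, ⟨hm, hm'⟩, hym⟩ := hf.exists_mem_joinedIn hyS ((hNo r).inter (hNo r'))
        (r := r') ⟨hr', hrN r'⟩
      exact (hN r y' hy' m hm (hyy'.symm.trans hym)).trans
        (hN r' m hm' z' hz' (hym.symm.trans hyz'))
    · refine ⟨fun r₁ r₂ r₃ h h' y' hy' z' hz' hyy' hyz' => ?_⟩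
      obtain ⟨m, hm, hym⟩ := hf.exists_mem_joinedIn hyS (hNo r₂) (hrN r₂)
      exact (h y' hy' m hm hyy' hym).trans (h' m hm z' hz' hym hyz')
  exact hrel y hr z hr' (JoinedIn.refl hyS) hyz

/-- Infinite concatenation of shrinking paths. -/
lemma exists_path_of_joinedIn_ball {F : Set (ℝ × ℝ)} {p : ℝ × ℝ} {y : ℕ → ℝ × ℝ}
    (h : ∀ n : ℕ, JoinedIn (F ∩ Metric.ball p (1 / (n + 1))) (y n) (y (n + 1))) :
    ∃ ψ : Path (y 0) p, ∀ τ, τ ≠ 1 → ψ τ ∈ F := by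
  choose P hP using h
  let φ : ℝ → ℝ × ℝ := fun t => (P ⌊t⌋₊).extend (t - ⌊t⌋₊)
  have hφP : ∀ t, φ t ∈ F ∩ Metric.ball p (1 / (⌊t⌋₊ + 1)) := fun t => by
    obtain ⟨τ, hτ⟩ : φ t ∈ range (P ⌊t⌋₊) := by
      rw [← Path.extend_range]
      exact ⟨_, rfl⟩
    rw [← hτ]
    exact hP _ τ
  have hφn : ∀ n : ℕ, EqOn φ (fun t => (P n).extend (t - n)) (Icc n (n + 1)) := by
    intro n t ht
    rcases ht.2.lt_or_eq with hlt | rfl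
    · have : ⌊t⌋₊ = n := (Nat.floor_eq_iff ((Nat.cast_nonneg n).trans ht.1)).2 ⟨ht.1, hlt⟩
      simp only [φ]
      rw [this]
    · have : ⌊(n : ℝ) + 1⌋₊ = n + 1 := by exact_mod_cast Nat.floor_natCast (n + 1)
      simp [φ, this]
  have hφc : Continuous φ := by
    have hIic : ∀ n : ℕ, ContinuousOn φ (Iic n) := by
      intro n
      induction n with
      | zero =>
        refine (continuousOn_const (c := y 0)).congr fun t ht => ?_
        have ht' : t ≤ 0 := by simpa using ht
        simp only [φ]
        rw [Nat.floor_of_nonpos ht']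
        exact (P 0).extend_of_le_zero (by simpa using ht')
      | succ n ih =>
        have : Iic (((n + 1 : ℕ) : ℝ)) = Iic (n : ℝ) ∪ Icc (n : ℝ) (n + 1) := by
          rw [Iic_union_Icc_eq_Iic (by linarith)]
          push_cast
          rfl
        rw [this]
        refine ih.union_of_isClosed (ContinuousOn.congr ?_ (hφn n)) isClosed_Iic isClosed_Icc
        exact ((P n).continuous_extend.comp (by fun_prop)).continuousOn
    refine continuous_iff_continuousAt.2 fun t => ?_
    obtain ⟨n, hn⟩ := exists_nat_gt t
    exact (hIic n).continuousAt (Iic_mem_nhds hn)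
  let ψ : I → ℝ × ℝ := fun τ => if (τ : ℝ) = 1 then p else φ (τ / (1 - τ))
  have hψ1 : ∀ τ : I, (τ : ℝ) ≠ 1 → 0 < 1 - (τ : ℝ) := fun τ hτ =>
    sub_pos.2 (lt_of_le_of_ne τ.2.2 hτ)
  have hψc : Continuous ψ := by
    refine continuous_iff_continuousAt.2 fun τ => ?_
    by_cases hτ : (τ : ℝ) = 1
    · have hψτ : ψ τ = p := if_pos hτ
      rw [Metric.continuousAt_iff', hψτ]
      intro ε hε
      obtain ⟨n, hn⟩ := exists_nat_one_div_lt hε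
      have hev : ∀ᶠ ξ : I in nhds τ, (n : ℝ) * (1 - ξ) < ξ :=
        (isOpen_lt (by fun_prop) (by fun_prop)).mem_nhds (by simp [hτ])
      filter_upwards [hev] with ξ hξ
      by_cases hξ1 : (ξ : ℝ) = 1
      · rw [show ψ ξ = p from if_pos hξ1, dist_self]
        exact hε
      · rw [show ψ ξ = φ (ξ / (1 - ξ)) from if_neg hξ1]
        have hle : n ≤ ⌊(ξ / (1 - ξ) : ℝ)⌋₊ := by
          refine Nat.le_floor ?_
          rw [le_div_iff₀ (hψ1 ξ hξ1)]
          exact hξ.le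
        refine lt_of_lt_of_le (hφP _).2 (le_trans ?_ hn.le)
        exact one_div_le_one_div_of_le (by positivity) (by exact_mod_cast Nat.succ_le_succ hle)
    · have hev : ψ =ᶠ[nhds τ] fun ξ : I => φ (ξ / (1 - ξ)) := by
        have : ∀ᶠ ξ : I in nhds τ, (ξ : ℝ) ≠ 1 :=
          (isOpen_ne_fun (by fun_prop) (by fun_prop)).mem_nhds hτ
        filter_upwards [this] with ξ hξ
        exact if_neg hξ
      refine ContinuousAt.congr ?_ hev.symm
      refine hφc.continuousAt.comp (ContinuousAt.div ?_ ?_ (hψ1 τ hτ).ne')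
      all_goals fun_prop
  refine ⟨⟨⟨ψ, hψc⟩, ?_, ?_⟩, fun τ hτ => ?_⟩
  · simp [ψ, φ]
  · simp [ψ]
  · have hτ' : (τ : ℝ) ≠ 1 := fun h => hτ (Subtype.ext h)
    change ψ τ ∈ F
    rw [show ψ τ = φ (τ / (1 - τ)) from if_neg hτ']
    exact (hφP _).1

/-- Every point of a separating arc is accessible from both sides. -/
lemma IsSeparatingArc.exists_path_to {f : ℝ → ℝ × ℝ} (hf : IsSeparatingArc f) (r₀ : ℝ)
    {O : Set (ℝ × ℝ)} (hO : IsOpen O) (hx : f r₀ ∈ O) :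
    ∃ N, IsOpen N ∧ f r₀ ∈ N ∧ ∀ y ∈ N, y ∉ range f →
      ∃ ψ : Path y (f r₀), ∀ τ, τ ≠ 1 → ψ τ ∈ O \ range f := by
  have key : ∀ n : ℕ, ∃ N, IsOpen N ∧ f r₀ ∈ N ∧ N ⊆ O ∩ Metric.ball (f r₀) (1 / (n + 1)) ∧
      ∀ y ∈ N, ∀ z ∈ N, JoinedIn (range f)ᶜ y z →
        JoinedIn ((O ∩ Metric.ball (f r₀) (1 / (n + 1))) \ range f) y z := fun n =>
    hf.isClosedEmbedding.exists_joinedIn_diff r₀ (hO.inter Metric.isOpen_ball)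
      ⟨hx, Metric.mem_ball_self (by positivity)⟩
  choose N hNo hrN _ hN using key
  refine ⟨N 0, hNo 0, hrN 0, fun y hy hyS => ?_⟩
  have hm : ∀ n, ∃ m ∈ N n ∩ N (n + 1), JoinedIn (range f)ᶜ y m := fun n =>
    hf.exists_mem_joinedIn hyS ((hNo n).inter (hNo (n + 1))) ⟨hrN n, hrN (n + 1)⟩
  choose m hmN hm using hm
  let Y : ℕ → ℝ × ℝ := fun n => Nat.casesOn n y m
  have hYN : ∀ n, Y n ∈ N n ∧ JoinedIn (range f)ᶜ y (Y n) := fun n => by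
    cases n with
    | zero => exact ⟨hy, JoinedIn.refl hyS⟩
    | succ n => exact ⟨(hmN n).2, hm n⟩
  refine exists_path_of_joinedIn_ball (y := Y) fun n => ?_
  refine (hN n (Y n) (hYN n).1 (Y (n + 1)) (hmN n).1
    ((hYN n).2.symm.trans (hYN (n + 1)).2)).mono ?_
  rintro w ⟨⟨h₁, h₂⟩, h₃⟩
  exact ⟨⟨h₁, h₃⟩, h₂⟩

/-- Near a point of a separating arc, any two points off the arc are joined by a local path meeting
the arc at most once. -/
lemma IsSeparatingArc.exists_path_crossing {f : ℝ → ℝ × ℝ} (hf : IsSeparatingArc f) (r₀ : ℝ)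
    {O : Set (ℝ × ℝ)} (hO : IsOpen O) (hx : f r₀ ∈ O) :
    ∃ N, IsOpen N ∧ f r₀ ∈ N ∧ ∀ y ∈ N, y ∉ range f → ∀ z ∈ N, z ∉ range f →
      ∃ κ : Path y z, (∀ t, κ t ∈ O) ∧ (κ ⁻¹' range f).Subsingleton := by
  obtain ⟨N, hNo, hrN, hN⟩ := hf.exists_path_to r₀ hO hx
  refine ⟨N, hNo, hrN, fun y hy hyS z hz hzS => ?_⟩
  obtain ⟨ψ, hψ⟩ := hN y hy hyS
  obtain ⟨ψ', hψ'⟩ := hN z hz hzS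
  have hO' : ∀ {w} (χ : Path w (f r₀)), (∀ τ, τ ≠ 1 → χ τ ∈ O \ range f) → ∀ τ, χ τ ∈ O := by
    intro w χ hχ τ
    by_cases hτ : τ = 1
    · rw [hτ, χ.target]
      exact hx
    · exact (hχ τ hτ).1
  refine ⟨ψ.trans ψ'.symm, fun t => ?_, ?_⟩
  · rw [Path.trans_apply]
    split_ifs
    · exact hO' ψ hψ _
    · exact hO' ψ' hψ' _
  · have hmid : ∀ t ∈ (ψ.trans ψ'.symm) ⁻¹' range f, (t : ℝ) = 1 / 2 := by
      intro t ht
      rw [mem_preimage, Path.trans_apply] at ht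
      split_ifs at ht with h
      · by_contra hne
        refine (hψ _ fun h1 => hne ?_).2 ht
        have := congrArg Subtype.val h1
        simp at this
        linarith
      · exfalso
        refine (hψ' _ fun h1 => h ?_).2 ht
        have := congrArg Subtype.val h1
        simp at this
        linarith
    exact fun t ht t' ht' => Subtype.ext ((hmid t ht).trans (hmid t' ht').symm)

lemma joinedIn_image_of_convex {g : ℝ × ℝ → ℝ × ℝ} (hg : Continuous g) {C F : Set (ℝ × ℝ)}
    (hC : Convex ℝ C) (hCF : ∀ q ∈ C, g q ∈ F) {q q' : ℝ × ℝ} (hq : q ∈ C) (hq' : q' ∈ C) :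
    JoinedIn F (g q) (g q') :=
  (((hC.isPathConnected ⟨q, hq⟩).joinedIn q hq q' hq').map hg).mono (image_subset_iff.2 hCF)

lemma joinedIn_image_of_ordConnected {g : ℝ → ℝ × ℝ} (hg : Continuous g) {C : Set ℝ}
    (hC : C.OrdConnected) {F : Set (ℝ × ℝ)} (hCF : ∀ q ∈ C, g q ∈ F) {q q' : ℝ} (hq : q ∈ C)
    (hq' : q' ∈ C) : JoinedIn F (g q) (g q') :=
  (((hC.convex.isPathConnected ⟨q, hq⟩).joinedIn q hq q' hq').map hg).mono (image_subset_iff.2 hCF)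

/-- An arc crossing a separating arc changes sides. -/
lemma IsSeparatingArc.not_joinedIn_of_isLocalCross {f : ℝ → ℝ × ℝ} (hf : IsSeparatingArc f)
    {g : ℝ → ℝ × ℝ} (hg : Topology.IsEmbedding g) (hfg : (range f ∩ range g).Subsingleton)
    {r₀ : ℝ} (hx : g r₀ ∈ range f) (hc : IsLocalCross (range f) (range g) (g r₀)) {r r' : ℝ}
    (hr : r < r₀) (hr' : r₀ < r') : ¬ JoinedIn (range f)ᶜ (g r) (g r') := by
  intro hj
  have hgf : ∀ ρ, ρ ≠ r₀ → g ρ ∉ range f := fun ρ hρ h =>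
    hρ (hg.injective (hfg ⟨h, ρ, rfl⟩ ⟨hx, r₀, rfl⟩))
  have hgj : ∀ ρ, ρ ≠ r₀ → JoinedIn (range f)ᶜ (g r) (g ρ) := fun ρ hρ => by
    rcases lt_or_gt_of_ne hρ with h | h
    · exact joinedIn_image_of_ordConnected hg.continuous ordConnected_Iio
        (fun q (hq : q < r₀) => hgf q hq.ne) hr h
    · exact hj.trans (joinedIn_image_of_ordConnected hg.continuous ordConnected_Ioi
        (fun q (hq : r₀ < q) => hgf q hq.ne') hr' h)
  obtain ⟨V, hV, hxV, h, h0, hS, hT⟩ := hc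
  have hcont : Continuous fun q => (h.symm q : ℝ × ℝ) :=
    continuous_subtype_val.comp h.symm.continuous
  have hS' : ∀ q : ℝ × ℝ, (h.symm q : ℝ × ℝ) ∈ range f ↔ q.2 = 0 := fun q =>
    Set.ext_iff.1 hS q
  have haxis : ∀ c : ℝ, c ≠ 0 → JoinedIn (range f)ᶜ (g r) (h.symm (0, c) : ℝ × ℝ) := by
    intro c hc
    have hmem : (0, c) ∈ (fun q => (h.symm q : ℝ × ℝ)) ⁻¹' range g := by
      rw [hT]
      rfl
    obtain ⟨ρ, hρ⟩ := hmem
    have hnot := (hS' (0, c)).not.2 hc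
    simp only at hρ
    rw [← hρ]
    refine hgj ρ ?_
    rintro rfl
    rw [← hρ] at hnot
    exact hnot hx
  have hVj : ∀ w ∈ V, w ∉ range f → JoinedIn (range f)ᶜ (g r) w := by
    intro w hw hwS
    obtain ⟨q, hq⟩ : ∃ q, (h.symm q : ℝ × ℝ) = w := ⟨h ⟨w, hw⟩, by simp⟩
    rw [← hq] at hwS ⊢
    rcases lt_or_gt_of_ne ((hS' q).not.1 hwS) with hlt | hlt
    · refine (haxis (-1) (by norm_num)).trans (joinedIn_image_of_convex hcont
        (C := {q | q.2 < 0}) ?_ (fun q' hq' => (hS' q').not.2 (ne_of_lt hq')) ?_ hlt)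
      · exact convex_halfSpace_lt ⟨fun _ _ => rfl, fun _ _ => rfl⟩ 0
      · simp
    · refine (haxis 1 (by norm_num)).trans (joinedIn_image_of_convex hcont
        (C := {q | 0 < q.2}) ?_ (fun q' hq' => (hS' q').not.2 (ne_of_gt hq')) ?_ hlt)
      · exact convex_halfSpace_gt ⟨fun _ _ => rfl, fun _ _ => rfl⟩ 0
      · simp
  obtain ⟨s, hs⟩ := hx
  rw [← hs] at hxV
  obtain ⟨p, q, hp, hq, hpq⟩ := hf.exists_not_joinedIn
  obtain ⟨m, hmV, hm⟩ := hf.exists_mem_joinedIn hp hV hxV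
  obtain ⟨m', hmV', hm'⟩ := hf.exists_mem_joinedIn hq hV hxV
  exact hpq (hm.trans ((hVj m hmV hm.target_mem).symm.trans
    ((hVj m' hmV' hm'.target_mem).trans hm'.symm)))

namespace Path

variable {X : Type*} [TopologicalSpace X] {a b c : X}

lemma trans_mem_of_forall {γ : Path a b} {δ : Path b c} {P : X → Prop} (hγ : ∀ t, P (γ t))
    (hδ : ∀ t, P (δ t)) (t : I) : P (γ.trans δ t) := by
  rw [trans_apply]
  split_ifs
  exacts [hγ _, hδ _]

lemma subsingleton_preimage_symm {γ : Path a b} {T : Set X} (hγ : (γ ⁻¹' T).Subsingleton) :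
    (γ.symm ⁻¹' T).Subsingleton := fun _ hs _ ht =>
  unitInterval.symm_bijective.injective (hγ hs ht)

lemma subsingleton_preimage_trans {γ : Path a b} {δ : Path b c} {T : Set X}
    (hγ : (γ ⁻¹' T).Subsingleton) (hδ : ∀ t, δ t ∉ T) : (γ.trans δ ⁻¹' T).Subsingleton := by
  intro s hs t ht
  rw [mem_preimage, trans_apply] at hs ht
  split_ifs at hs ht
  · have := congrArg Subtype.val (hγ hs ht)
    exact Subtype.ext (by simpa using this)
  all_goals exact absurd ‹_› (hδ _)

lemma subsingleton_preimage_trans' {γ : Path a b} {δ : Path b c} {T : Set X}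
    (hγ : ∀ t, γ t ∉ T) (hδ : (δ ⁻¹' T).Subsingleton) : (γ.trans δ ⁻¹' T).Subsingleton := by
  rw [← (γ.trans δ).symm_symm, trans_symm]
  exact subsingleton_preimage_symm
    (subsingleton_preimage_trans (subsingleton_preimage_symm hδ) fun t => hγ _)

lemma exists_initial (γ : Path a b) (u : I) : ∃ γ₁ : Path a (γ u), (∀ t, ∃ s ≤ u, γ₁ t = γ s) ∧
    ∀ T : Set X, (γ ⁻¹' T).Subsingleton → γ u ∉ T → (γ₁ ⁻¹' T).Subsingleton := by
  refine ⟨⟨⟨fun t => γ (t * u), by fun_prop⟩, by simp, by simp⟩,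
    fun t => ⟨t * u, unitInterval.mul_le_right, rfl⟩, fun T hT huT s hs t ht => ?_⟩
  have heq : s * u = t * u := hT hs ht
  by_cases hu : u = 0
  · subst hu
    refine absurd ?_ huT
    simpa using hs
  · have hu' : (u : ℝ) ≠ 0 := fun h => hu (Subtype.ext h)
    exact Subtype.ext (mul_right_cancel₀ hu' (by simpa using congrArg Subtype.val heq))

lemma exists_final (γ : Path a b) (v : I) : ∃ γ₂ : Path (γ v) b, (∀ t, ∃ s ≥ v, γ₂ t = γ s) ∧
    ∀ T : Set X, (γ ⁻¹' T).Subsingleton → γ v ∉ T → (γ₂ ⁻¹' T).Subsingleton := by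
  obtain ⟨δ, hδ, hδT⟩ := γ.symm.exists_initial (σ v)
  have hv : γ.symm (σ v) = γ v := by simp
  refine ⟨(δ.cast rfl hv.symm).symm, fun t => ?_, fun T hT hvT => ?_⟩
  · obtain ⟨s, hs, he⟩ := hδ (σ t)
    refine ⟨σ s, ?_, he⟩
    rw [ge_iff_le, ← unitInterval.symm_symm v]
    exact unitInterval.symm_le_symm.2 hs
  · exact subsingleton_preimage_symm (hδT T (subsingleton_preimage_symm hT) (hv ▸ hvT))

/-- Replacing the part of a path between two times. -/
lemma exists_splice (γ : Path a b) {u v : I} (huv : u < v) (ω : Path (γ u) (γ v)) :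
    ∃ γ' : Path a b, (∀ t, (∃ s, γ' t = ω s) ∨ ∃ s, (s ≤ u ∨ v ≤ s) ∧ γ' t = γ s) ∧
      (∀ T : Set X, (ω ⁻¹' T).Subsingleton → (∀ s, s ≤ u ∨ v ≤ s → γ s ∉ T) →
        (γ' ⁻¹' T).Subsingleton) ∧
      ∀ T : Set X, (γ ⁻¹' T).Subsingleton → (∀ t, ω t ∉ T) → (γ' ⁻¹' T).Subsingleton := by
  obtain ⟨γ₁, h₁, h₁T⟩ := γ.exists_initial u
  obtain ⟨γ₂, h₂, h₂T⟩ := γ.exists_final v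
  have h₁avoid : ∀ T : Set X, (∀ s ≤ u, γ s ∉ T) → ∀ t, γ₁ t ∉ T := fun T hT t => by
    obtain ⟨s, hs, he⟩ := h₁ t
    exact he ▸ hT s hs
  have h₂avoid : ∀ T : Set X, (∀ s ≥ v, γ s ∉ T) → ∀ t, γ₂ t ∉ T := fun T hT t => by
    obtain ⟨s, hs, he⟩ := h₂ t
    exact he ▸ hT s hs
  refine ⟨(γ₁.trans ω).trans γ₂, ?_, fun T hω hγ => ?_, fun T hγ hω => ?_⟩
  · refine trans_mem_of_forall (P := fun x => (∃ s, x = ω s) ∨ ∃ s, (s ≤ u ∨ v ≤ s) ∧ x = γ s)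
      (trans_mem_of_forall (P := fun x => (∃ s, x = ω s) ∨ ∃ s, (s ≤ u ∨ v ≤ s) ∧ x = γ s)
        (fun t => ?_) fun t => ?_) fun t => ?_
    · obtain ⟨s, hs, he⟩ := h₁ t
      exact Or.inr ⟨s, Or.inl hs, he⟩
    · exact Or.inl ⟨t, rfl⟩
    · obtain ⟨s, hs, he⟩ := h₂ t
      exact Or.inr ⟨s, Or.inr hs, he⟩
  · exact subsingleton_preimage_trans
      (subsingleton_preimage_trans' (h₁avoid T fun s hs => hγ s (Or.inl hs)) hω)
      (h₂avoid T fun s hs => hγ s (Or.inr hs))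
  · have hu : γ u ∉ T := by simpa using hω 0
    have hv : γ v ∉ T := by simpa using hω 1
    by_cases h : ∃ s ≤ u, γ s ∈ T
    · obtain ⟨s, hs, hsT⟩ := h
      refine subsingleton_preimage_trans (subsingleton_preimage_trans (h₁T T hγ hu) hω)
        (h₂avoid T fun s' hs' hs'T => ?_)
      exact absurd (hγ hsT hs'T) (hs.trans_lt (huv.trans_le hs')).ne
    · push Not at h
      exact subsingleton_preimage_trans' (trans_mem_of_forall (P := fun x => x ∉ T)
        (h₁avoid T h) hω) (h₂T T hγ hv)

end Path

/-- The first and the last point of a path on a separating arc can be bypassed by a local crossing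
at the first point followed by a path along one side of the arc. -/
lemma IsSeparatingArc.exists_bypass {f : ℝ → ℝ × ℝ} (hf : IsSeparatingArc f) {a b : ℝ × ℝ}
    (γ : Path a b) (ha : a ∉ range f) (hb : b ∉ range f) (hγ : ∃ t, γ t ∈ range f) :
    ∃ u v : I, u ≤ v ∧ γ u ∈ range f ∧ γ v ∈ range f ∧
      ∀ O, IsOpen O → γ u ∈ O → γ v ∈ O → ∃ u' v' : I, u' < u ∧ v < v' ∧ γ u' ∈ O ∧ γ v' ∈ O ∧
        (∀ s, s ≤ u' ∨ v' ≤ s → γ s ∉ range f) ∧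
        ∃ z ∈ O, JoinedIn (range f)ᶜ z (γ v') ∧ ∃ κ : Path (γ u') z,
          (∀ t, κ t ∈ O) ∧ (κ ⁻¹' range f).Subsingleton := by
  have hC : IsCompact (γ ⁻¹' range f) :=
    (hf.isClosedEmbedding.isClosed_range.preimage γ.continuous).isCompact
  obtain ⟨u, hu, humin⟩ := hC.exists_isLeast hγ
  obtain ⟨v, hv, hvmax⟩ := hC.exists_isGreatest hγ
  refine ⟨u, v, humin hv, hu, hv, fun O hO huO hvO => ?_⟩
  obtain ⟨r, hr⟩ := id hu
  obtain ⟨N, hN, hrN, hcross⟩ := hf.exists_path_crossing r hO (by rwa [hr])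
  rw [hr] at hrN
  have hu0 : 0 < u := unitInterval.pos_iff_ne_zero.2 fun h => ha (by simpa [h] using hu)
  have hv1 : v < 1 := unitInterval.lt_one_iff_ne_one.2 fun h => hb (by simpa [h] using hv)
  have hne : (nhdsWithin u (Iio u)).NeBot := nhdsLT_neBot_of_exists_lt ⟨0, hu0⟩
  have hne' : (nhdsWithin v (Ioi v)).NeBot := nhdsGT_neBot_of_exists_gt ⟨1, hv1⟩
  have hev : ∀ᶠ s in nhds u, γ s ∈ O ∩ N :=
    ((hO.inter hN).preimage γ.continuous).mem_nhds ⟨huO, hrN⟩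
  have hev' : ∀ᶠ s in nhds v, γ s ∈ O := (hO.preimage γ.continuous).mem_nhds hvO
  obtain ⟨u', ⟨hu'O, hu'N⟩, hu'⟩ := ((hev.filter_mono nhdsWithin_le_nhds).and
    (eventually_mem_nhdsWithin (s := Iio u))).exists
  obtain ⟨v', hv'O, hv'⟩ := ((hev'.filter_mono nhdsWithin_le_nhds).and
    (eventually_mem_nhdsWithin (s := Ioi v))).exists
  have havoid : ∀ s, s ≤ u' ∨ v' ≤ s → γ s ∉ range f := by
    rintro s (hs | hs) h
    · exact absurd (humin h) (not_le.2 (hs.trans_lt hu'))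
    · exact absurd (hvmax h) (not_le.2 (lt_of_lt_of_le hv' hs))
  obtain ⟨z, ⟨hzO, hzN⟩, hz⟩ := hf.exists_mem_joinedIn (havoid v' (Or.inr le_rfl)) (hO.inter hN)
    (r := r) (by rw [hr]; exact ⟨huO, hrN⟩)
  exact ⟨u', v', hu', hv', hu'O, hv'O, havoid, z, hzO, hz.symm,
    hcross _ hu'N (havoid u' (Or.inl le_rfl)) z hzN hz.target_mem⟩

/-- A path in `W₁` can be modified inside `W` to meet each arc of a finite family at most once, if
arcs of the family between points of `W₁` stay in `W` and off the other arcs. -/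
lemma JoinedIn.exists_path_subsingleton {ι : Type*} {F : ι → ℝ → ℝ × ℝ} {s : Finset ι}
    (hF : ∀ i ∈ s, IsSeparatingArc (F i)) {W W₁ : Set (ℝ × ℝ)} (hW : IsOpen W) (hW₁ : W₁ ⊆ W)
    (H : ∀ i ∈ s, ∀ r r', F i r ∈ W₁ → F i r' ∈ W₁ → ∀ x ∈ uIcc r r',
      F i x ∈ W ∧ ∀ j ∈ s, j ≠ i → F i x ∉ range (F j))
    {y z : ℝ × ℝ} (hyz : JoinedIn W₁ y z) (hy : ∀ i ∈ s, y ∉ range (F i))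
    (hz : ∀ i ∈ s, z ∉ range (F i)) :
    ∃ γ : Path y z, (∀ t, γ t ∈ W) ∧ ∀ i ∈ s, (γ ⁻¹' range (F i)).Subsingleton := by
  classical
  suffices key : ∀ s' ⊆ s, ∃ γ : Path y z, (∀ t, γ t ∈ W) ∧
      (∀ i ∈ s', (γ ⁻¹' range (F i)).Subsingleton) ∧
      ∀ i ∈ s, i ∉ s' → ∀ t, γ t ∈ range (F i) → γ t ∈ W₁ by
    obtain ⟨γ, h₁, h₂, -⟩ := key s subset_rfl
    exact ⟨γ, h₁, h₂⟩
  intro s'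
  induction s' using Finset.induction_on with
  | empty =>
    intro _
    obtain ⟨γ, hγ⟩ := hyz
    exact ⟨γ, fun t => hW₁ (hγ t), by simp, fun _ _ _ t _ => hγ t⟩
  | insert i s' hi ih =>
    intro hs
    have his : i ∈ s := hs (Finset.mem_insert_self i s')
    obtain ⟨γ, hγW, hγs', hγW₁⟩ := ih ((Finset.subset_insert i s').trans hs)
    by_cases hhit : ∃ t, γ t ∈ range (F i)
    swap
    · push Not at hhit
      refine ⟨γ, hγW, fun j hj => ?_, fun j hj hjs => hγW₁ j hj fun h =>
        hjs (Finset.mem_insert_of_mem h)⟩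
      rcases Finset.mem_insert.1 hj with rfl | hj
      · exact fun t ht => absurd ht (hhit t)
      · exact hγs' j hj
    obtain ⟨u, v, huv, ⟨r, hr⟩, ⟨r', hr'⟩, hbypass⟩ :=
      (hF i his).exists_bypass γ (hy i his) (hz i his) hhit
    have hH := H i his r r' (hr ▸ hγW₁ i his hi u ⟨r, hr⟩) (hr' ▸ hγW₁ i his hi v ⟨r', hr'⟩)
    have hN₀ : IsOpen (W \ ⋃ j ∈ s.erase i, range (F j)) :=
      hW.sdiff (isClosed_biUnion_finset fun j hj =>
        (hF j (Finset.mem_of_mem_erase hj)).isClosedEmbedding.isClosed_range)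
    obtain ⟨N, hN, hZN, hNN₀, hstrip⟩ := (hF i his).exists_strip (min r r') (max r r') hN₀ (by
      rintro _ ⟨x, hx, rfl⟩
      refine ⟨(hH x hx).1, fun h => ?_⟩
      obtain ⟨j, hj, hxj⟩ := mem_iUnion₂.1 h
      exact (hH x hx).2 j (Finset.mem_of_mem_erase hj) (Finset.ne_of_mem_erase hj) hxj)
    obtain ⟨u', v', hu', hv', hu'N, hv'N, havoid, w, hwN, hw, κ, hκN, hκ⟩ := hbypass N hN
      (hr ▸ hZN ⟨r, left_mem_uIcc, rfl⟩) (hr' ▸ hZN ⟨r', right_mem_uIcc, rfl⟩)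
    obtain ⟨δ, hδ⟩ := hstrip w hwN _ hv'N hw
    have hω : ∀ t, κ.trans δ t ∈ W \ ⋃ j ∈ s.erase i, range (F j) :=
      Path.trans_mem_of_forall (P := fun x => x ∈ W \ ⋃ j ∈ s.erase i, range (F j))
        (fun t => hNN₀ (hκN t)) fun t => (hδ t).1
    have hωj : ∀ j ∈ s, j ≠ i → ∀ t, κ.trans δ t ∉ range (F j) := fun j hj hji t h =>
      (hω t).2 (mem_iUnion₂.2 ⟨j, Finset.mem_erase.2 ⟨hji, hj⟩, h⟩)
    obtain ⟨γ', hγ', hγ'₁, hγ'₂⟩ := γ.exists_splice (hu'.trans_le (huv.trans hv'.le)) (κ.trans δ)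
    refine ⟨γ', fun t => ?_, fun j hj => ?_, fun j hj hjs t ht => ?_⟩
    · rcases hγ' t with ⟨x, hx⟩ | ⟨x, -, hx⟩ <;> rw [hx]
      exacts [(hω x).1, hγW x]
    · rcases Finset.mem_insert.1 hj with rfl | hj'
      · exact hγ'₁ _ (Path.subsingleton_preimage_trans hκ fun t => (hδ t).2) havoid
      · exact hγ'₂ _ (hγs' j hj') (hωj j (hs hj) fun h => hi (h ▸ hj'))
    · rw [Finset.mem_insert, not_or] at hjs
      rcases hγ' t with ⟨x, hx⟩ | ⟨x, -, hx⟩ <;> rw [hx] at ht ⊢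
      · exact absurd ht (hωj j hj hjs.1 x)
      · exact hγW₁ j hj hjs.2 x ht

lemma JoinedIn.inter_pathComponentIn {A S : Set (ℝ × ℝ)} {z w : ℝ × ℝ}
    (h : JoinedIn (A \ S) z w) : JoinedIn (A ∩ pathComponentIn Sᶜ w) z w := by
  obtain ⟨γ, hγ⟩ := h
  exact ⟨γ, fun t => ⟨(hγ t).1, (γ.subpath 1 t).cast γ.target.symm rfl, fun x => (hγ _).2⟩⟩

/-- A path between two points of an arc crosses every separating arc crossing strictly between. -/
lemma IsSeparatingArc.exists_mem_of_isLocalCross {f : ℝ → ℝ × ℝ} (hf : IsSeparatingArc f)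
    {g : ℝ → ℝ × ℝ} (hg : Topology.IsEmbedding g) (hfg : (range f ∩ range g).Subsingleton)
    {x : ℝ} (hx : g x ∈ range f) (hc : IsLocalCross (range f) (range g) (g x)) {r r' : ℝ}
    (hxr : x ∈ uIcc r r') {a b : ℝ × ℝ} (γ : Path a b) {u v : I} (huv : u ≤ v)
    (hu : g r = γ u) (hv : g r' = γ v) (hur : γ u ∉ range f) (hvr : γ v ∉ range f) :
    ∃ t ∈ Icc u v, γ t ∈ range f := by
  by_contra! hcon
  have hj : JoinedIn (range f)ᶜ (γ u) (γ v) := by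
    refine ⟨γ.subpath u v, fun t => ?_⟩
    have : γ.subpath u v t ∈ γ '' Icc u v := by
      rw [← Path.range_subpath_of_le γ u v huv]
      exact ⟨t, rfl⟩
    obtain ⟨t', ht', he⟩ := this
    rw [← he]
    exact hcon t' ht'
  rw [← hu] at hur hj
  rw [← hv] at hvr hj
  have h₁ : x ≠ r := fun h => hur (h ▸ hx)
  have h₂ : x ≠ r' := fun h => hvr (h ▸ hx)
  rcases mem_uIcc.1 hxr with h | h
  · exact hf.not_joinedIn_of_isLocalCross hg hfg hx hc (lt_of_le_of_ne h.1 h₁.symm)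
      (lt_of_le_of_ne h.2 h₂) hj
  · exact hf.not_joinedIn_of_isLocalCross hg hfg hx hc (lt_of_le_of_ne h.1 h₂.symm)
      (lt_of_le_of_ne h.2 h₁) hj.symm

/-- Two points of a crossing arc on the same side of a separating arc span a subarc on that side. -/
lemma IsSeparatingArc.joinedIn_of_mem_uIcc {f : ℝ → ℝ × ℝ} (hf : IsSeparatingArc f)
    {g : ℝ → ℝ × ℝ} (hg : Topology.IsEmbedding g) (hfg : (range f ∩ range g).Subsingleton)
    {ρ : ℝ} (hρ : g ρ ∈ range f) (hc : IsLocalCross (range f) (range g) (g ρ)) {r r' : ℝ}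
    (hj : JoinedIn (range f)ᶜ (g r) (g r')) {x : ℝ} (hx : x ∈ uIcc r r') :
    JoinedIn (range f)ᶜ (g r) (g x) := by
  have hmem : ρ ∉ uIcc r r' := fun h => by
    have h₁ : ρ ≠ r := fun h => hj.source_mem (h ▸ hρ)
    have h₂ : ρ ≠ r' := fun h => hj.target_mem (h ▸ hρ)
    rcases mem_uIcc.1 h with h | h
    · exact hf.not_joinedIn_of_isLocalCross hg hfg hρ hc (lt_of_le_of_ne h.1 h₁.symm)
        (lt_of_le_of_ne h.2 h₂) hj
    · exact hf.not_joinedIn_of_isLocalCross hg hfg hρ hc (lt_of_le_of_ne h.1 h₂.symm)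
        (lt_of_le_of_ne h.2 h₁) hj.symm
  refine joinedIn_image_of_ordConnected hg.continuous ordConnected_uIcc (F := (range f)ᶜ)
    (fun q hq h => hmem ?_) left_mem_uIcc hx
  rwa [hg.injective (hfg ⟨hρ, ρ, rfl⟩ ⟨h, q, rfl⟩)]

/-- Two points off a finite family of separating arcs, any two of which meet at most once and cross
there, are joined by a path through no intersection point meeting each arc at most once. -/
lemma exists_path_subsingleton_of_isSeparatingArc {ι : Type*} [Finite ι] {F : ι → ℝ → ℝ × ℝ}
    (hF : ∀ i, IsSeparatingArc (F i))
    (hsub : ∀ i j, i ≠ j → (range (F i) ∩ range (F j)).Subsingleton)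
    (hcross : ∀ i j, i ≠ j → ∀ x ∈ range (F i) ∩ range (F j),
      IsLocalCross (range (F i)) (range (F j)) x)
    {a b : ℝ × ℝ} (ha : ∀ i, a ∉ range (F i)) (hb : ∀ i, b ∉ range (F i)) (s : Finset ι) :
    ∃ γ : Path a b, (∀ t i j, i ≠ j → γ t ∉ range (F i) ∩ range (F j)) ∧
      ∀ i ∈ s, (γ ⁻¹' range (F i)).Subsingleton := by
  classical
  set D : Set (ℝ × ℝ) := ⋃ i, ⋃ j, ⋃ _ : i ≠ j, range (F i) ∩ range (F j) with hD
  have hDfin : D.Finite :=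
    finite_iUnion fun i => finite_iUnion fun j => finite_iUnion fun h => (hsub i j h).finite
  have hmemD : ∀ {i j x}, i ≠ j → x ∈ range (F i) → x ∈ range (F j) → x ∈ D :=
    fun {i j x} h h₁ h₂ => mem_iUnion.2 ⟨i, mem_iUnion₂.2 ⟨j, h, h₁, h₂⟩⟩
  have hDmem : ∀ x ∈ D, ∃ i, x ∈ range (F i) := fun x hx => by
    obtain ⟨i, hx⟩ := mem_iUnion.1 hx
    obtain ⟨j, h, hx⟩ := mem_iUnion₂.1 hx
    exact ⟨i, hx.1⟩
  suffices key : ∃ γ : Path a b, (∀ t, γ t ∉ D) ∧ ∀ i ∈ s, (γ ⁻¹' range (F i)).Subsingleton by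
    obtain ⟨γ, h₁, h₂⟩ := key
    exact ⟨γ, fun t i j hij h => h₁ t (hmemD hij h.1 h.2), h₂⟩
  induction s using Finset.induction_on with
  | empty =>
    have haD : a ∉ D := fun h => (hDmem a h).elim ha
    have hbD : b ∉ D := fun h => (hDmem b h).elim hb
    obtain ⟨γ, hγ⟩ := (hDfin.countable.isPathConnected_compl_of_one_lt_rank
      (by simp [one_add_one_eq_two])).joinedIn a haD b hbD
    exact ⟨γ, hγ, by simp⟩
  | insert i s hi ih =>
    obtain ⟨γ, hγD, hγs⟩ := ih
    by_cases hhit : ∃ t, γ t ∈ range (F i)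
    swap
    · push Not at hhit
      refine ⟨γ, hγD, fun j hj => ?_⟩
      rcases Finset.mem_insert.1 hj with rfl | hj
      · exact fun t ht => absurd ht (hhit t)
      · exact hγs j hj
    obtain ⟨u, v, huv, ⟨r₁, hr₁⟩, ⟨r₂, hr₂⟩, hbypass⟩ :=
      (hF i).exists_bypass γ (ha i) (hb i) hhit
    have hne : ∀ j ∈ s, j ≠ i := fun j hj h => hi (h ▸ hj)
    have hcl : ∀ j, IsClosed (range (F j)) := fun j => (hF j).isClosedEmbedding.isClosed_range
    set Z := F i '' uIcc r₁ r₂ with hZ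
    have huZ : γ u ∈ Z := ⟨r₁, left_mem_uIcc, hr₁⟩
    have hvZ : γ v ∈ Z := ⟨r₂, right_mem_uIcc, hr₂⟩
    have hZS : Z ⊆ range (F i) := image_subset_range _ _
    set s₀ := s.filter fun j => (range (F j) ∩ Z).Nonempty with hs₀
    have hs₀s : ∀ j ∈ s₀, j ∈ s := fun j hj => (Finset.mem_filter.1 hj).1
    set N₀ := ((⋃ j ∈ s \ s₀, range (F j)) ∪ D \ Z)ᶜ with hN₀
    have hN₀o : IsOpen N₀ :=
      ((isClosed_biUnion_finset fun j _ => hcl j).union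
        (hDfin.subset sdiff_subset).isClosed).isOpen_compl
    have hN₀j : ∀ j ∈ s, j ∉ s₀ → ∀ x ∈ N₀, x ∉ range (F j) := fun j hj hj₀ x hx h =>
      hx (Or.inl (mem_iUnion₂.2 ⟨j, Finset.mem_sdiff.2 ⟨hj, hj₀⟩, h⟩))
    have hN₀D : ∀ x ∈ N₀, x ∈ D → x ∈ range (F i) := fun x hx hxD =>
      hZS (by_contra fun h => hx (Or.inr ⟨hxD, h⟩))
    have hZN₀ : Z ⊆ N₀ := by
      rintro x hx (h | h)
      · obtain ⟨j, hj, hxj⟩ := mem_iUnion₂.1 h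
        rw [Finset.mem_sdiff, hs₀, Finset.mem_filter, not_and] at hj
        exact hj.2 hj.1 ⟨x, hxj, hx⟩
      · exact h.2 hx
    have hρ : ∀ j, ∃ ρ, ∃ η > 0, j ∈ s₀ → F j ρ ∈ Z ∧ ∀ r, |r - ρ| ≤ η → F j r ∈ N₀ := by
      intro j
      by_cases hj : j ∈ s₀
      · obtain ⟨_, ⟨ρ, rfl⟩, hρ⟩ := (Finset.mem_filter.1 hj).2
        obtain ⟨η, hη, h⟩ := (hF j).isClosedEmbedding.isEmbedding.exists_image_Icc_subset ρ hN₀o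
          (hZN₀ hρ)
        exact ⟨ρ, η, hη, fun _ => ⟨hρ, h⟩⟩
      · exact ⟨0, 1, one_pos, fun h => absurd h hj⟩
    choose ρ η hη hρη using hρ
    set N₁ := N₀ \ ⋃ j ∈ s₀, F j '' {r | η j ≤ |r - ρ j|} with hN₁
    have hN₁o : IsOpen N₁ := hN₀o.sdiff (isClosed_biUnion_finset fun j _ =>
      (hF j).isClosedEmbedding.isClosedMap _ (isClosed_setOf_le_abs_sub _ _))
    have hZN₁ : Z ⊆ N₁ := by
      refine fun x hx => ⟨hZN₀ hx, fun h => ?_⟩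
      obtain ⟨j, hj, r, hr, rfl⟩ := mem_iUnion₂.1 h
      have heq : F j r = F j (ρ j) := hsub i j (hne j (hs₀s j hj)).symm
        ⟨hZS hx, r, rfl⟩ ⟨hZS (hρη j hj).1, ρ j, rfl⟩
      rw [(hF j).isClosedEmbedding.injective heq] at hr
      have hr' : η j ≤ |ρ j - ρ j| := hr
      rw [sub_self, abs_zero] at hr'
      exact absurd hr' (not_le.2 (hη j))
    obtain ⟨N₂, hN₂o, hZN₂, hN₂N₁, hstrip⟩ := (hF i).exists_strip (min r₁ r₂) (max r₁ r₂) hN₁o hZN₁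
    set O := N₂ \ ((⋃ j ∈ s, range (F j)) ∪ D) with hO
    have hOo : IsOpen O :=
      hN₂o.sdiff ((isClosed_biUnion_finset fun j _ => hcl j).union hDfin.isClosed)
    have hOj : ∀ j ∈ s, ∀ x ∈ O, x ∉ range (F j) := fun j hj x hx h =>
      hx.2 (Or.inl (mem_iUnion₂.2 ⟨j, hj, h⟩))
    have hSO : ∀ t, γ t ∈ Z → γ t ∈ O := fun t ht => by
      refine ⟨hZN₂ ht, ?_⟩
      rintro (h | h)
      · obtain ⟨j, hj, htj⟩ := mem_iUnion₂.1 h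
        exact hγD t (hmemD (hne j hj) htj (hZS ht))
      · exact hγD t h
    obtain ⟨u', v', hu', hv', hu'O, hv'O, havoid, z, hzO, hz, κ, hκO, hκ⟩ :=
      hbypass O hOo (hSO u huZ) (hSO v hvZ)
    set P := pathComponentIn (range (F i))ᶜ (γ v') with hP
    have hPo : IsOpen P := (hcl i).isOpen_compl.pathComponentIn _
    have hzj : JoinedIn (N₁ ∩ P) z (γ v') :=
      (hstrip z hzO.1 _ hv'O.1 hz).inter_pathComponentIn
    obtain ⟨δ, hδW, hδ⟩ := hzj.exists_path_subsingleton (F := F) (s := s₀) (fun j _ => hF j)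
      (hN₀o.inter hPo) (inter_subset_inter_left _ sdiff_subset) (by
        intro j hj r r' hr hr' x hx
        have hji := hne j (hs₀s j hj)
        have hlt : ∀ r, F j r ∈ N₁ ∩ P → |r - ρ j| < η j := fun r hr => by
          by_contra! h
          exact hr.1.2 (mem_iUnion₂.2 ⟨j, hj, r, h, rfl⟩)
        have hxN₀ : F j x ∈ N₀ := by
          refine (hρη j hj).2 x ?_
          have h₁ := abs_lt.1 (hlt r hr)
          have h₂ := abs_lt.1 (hlt r' hr')
          rw [abs_le]
          rcases mem_uIcc.1 hx with h | h
          · exact ⟨by linarith, by linarith⟩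
          · exact ⟨by linarith, by linarith⟩
        have hρS := hZS (hρη j hj).1
        have hxP : JoinedIn (range (F i))ᶜ (F j r) (F j x) :=
          (hF i).joinedIn_of_mem_uIcc (hF j).isClosedEmbedding.isEmbedding (hsub i j hji.symm)
            hρS (hcross i j hji.symm _ ⟨hρS, ρ j, rfl⟩) (hr.2.symm.trans hr'.2) hx
        exact ⟨⟨hxN₀, hr.2.trans hxP⟩, fun k _ hkj hk => hxP.target_mem
          (hN₀D _ hxN₀ (hmemD hkj hk ⟨x, rfl⟩))⟩)
      (fun j hj => hOj j (hs₀s j hj) z hzO) (fun j hj => hOj j (hs₀s j hj) _ hv'O)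
    have hδS : ∀ t, δ t ∉ range (F i) := fun t => (hδW t).2.target_mem
    obtain ⟨γ', hγ', hγ'₁, hγ'₂⟩ := γ.exists_splice (hu'.trans_le (huv.trans hv'.le)) (κ.trans δ)
    refine ⟨γ', fun t => ?_, fun j hj => ?_⟩
    · rcases hγ' t with ⟨x, hx⟩ | ⟨x, -, hx⟩ <;> rw [hx]
      · exact Path.trans_mem_of_forall (P := fun x => x ∉ D)
          (fun t h => (hκO t).2 (Or.inr h)) (fun t h => hδS t (hN₀D _ (hδW t).1 h)) x
      · exact hγD x
    · rcases Finset.mem_insert.1 hj with rfl | hj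
      · exact hγ'₁ _ (Path.subsingleton_preimage_trans hκ hδS) havoid
      have hκj : ∀ t, κ t ∉ range (F j) := fun t => hOj j hj _ (hκO t)
      by_cases hj₀ : j ∈ s₀
      · refine hγ'₁ _ (Path.subsingleton_preimage_trans' hκj (hδ j hj₀)) ?_
        obtain ⟨hρZ, -⟩ := hρη j hj₀
        obtain ⟨x, hx, hxρ⟩ := id hρZ
        have hxj : F i x ∈ range (F j) := ⟨ρ j, hxρ.symm⟩
        obtain ⟨t, ht, htj⟩ := (hF j).exists_mem_of_isLocalCross
          (hF i).isClosedEmbedding.isEmbedding (hsub j i (hne j hj)) hxj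
          (hcross j i (hne j hj) _ ⟨hxj, x, rfl⟩) hx γ huv hr₁ hr₂
          (hOj j hj _ (hSO u huZ)) (hOj j hj _ (hSO v hvZ))
        rintro y hy hyj
        have hyt : y = t := hγs j hj hyj htj
        rcases hy with hy | hy
        · exact absurd (hyt ▸ hy) (not_le.2 (hu'.trans_le ht.1))
        · exact absurd (hyt ▸ hy) (not_le.2 (ht.2.trans_lt hv'))
      · exact hγ'₂ _ (hγs j hj) (Path.trans_mem_of_forall (P := fun x => x ∉ range (F j)) hκj
          fun t => hN₀j j hj hj₀ _ (hδW t).1)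

/-- For any arrangement of arcs `Σ` in the plane and points `a`, `b` not on
any arc, there is a path from `a` to `b` (a dual path of the arrangement) crossing each
arc of `Σ` at most once. -/
theorem exists_dual_path (A : ArcArrangement) (a b : ℝ × ℝ)
    (ha : a ∉ ⋃₀ A.arcs) (hb : b ∉ ⋃₀ A.arcs) :
    ∃ γ : Path a b, A.IsDualPath γ := by
  have := A.finite.to_subtype
  have := Fintype.ofFinite A.arcs
  choose F hF hFr using fun S : A.arcs => A.isArc S S.2
  have hsep : ∀ S, IsSeparatingArc (F S) := fun S =>
    (hF S).isSeparatingArc (by rw [hFr]; exact A.separates S S.2)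
  have hne : ∀ S T : A.arcs, S ≠ T → (S : Set (ℝ × ℝ)) ≠ T := fun S T h h' => h (Subtype.ext h')
  obtain ⟨γ, hγ, hγ'⟩ := exists_path_subsingleton_of_isSeparatingArc hsep
    (fun S T h => by
      rw [hFr, hFr]
      exact A.meet_once S S.2 T T.2 (hne S T h))
    (fun S T h x hx => by
      rw [hFr, hFr] at *
      exact A.meet_cross S S.2 T T.2 (hne S T h) x hx)
    (a := a) (b := b) (fun S h => ha ⟨S, S.2, hFr S ▸ h⟩) (fun S h => hb ⟨S, S.2, hFr S ▸ h⟩)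
    Finset.univ
  refine ⟨γ, ?_, fun S hS => ?_⟩
  · rw [disjoint_left]
    rintro _ ⟨t, rfl⟩ ⟨S, hS, T, hT, hST, hx⟩
    refine hγ t ⟨S, hS⟩ ⟨T, hT⟩ (fun h => hST (congrArg Subtype.val h)) ?_
    rwa [hFr, hFr]
  · rintro _ ⟨⟨t, rfl⟩, ht⟩ _ ⟨⟨t', rfl⟩, ht'⟩
    have := hγ' ⟨S, hS⟩ (Finset.mem_univ _)
    rw [hFr] at this
    rw [this ht ht']
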